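/- Let H be a separable real Hilbert space, D a bounded positive operator on H, Φ a Hilbert–Schmidt operator on H, β > 0, and set R₀ := D^β Φ D^β and C₀ := D^{1/2} R₀ D^{1/2}. Let (Ω, P) be a probability space, and let Ĉ₀ (valued in the Hilbert–Schmidt operators on H) and D̂ (valued in the bounded positive operators on H, with D̂ − D Hilbert–Schmidt) be random operators. Let 0 < δ ≤ 1 and η ∈ [0, 1], and suppose P( ‖Ĉ₀ − C₀‖₂ ≤ δ and ‖D̂ − D‖₂ ≤ δ ) ≥ 1 − η. Set b := min(β, 1), ε := δ^{1/(1+b)}, R̂₀ := (εI + D̂)^{−1/2} Ĉ₀ (εI + D̂)^{−1/2}, and κ := 8 · max( 1 + ‖R₀‖₂ , ‖Φ‖₂ ‖D‖^{2β − b} ). Then P( ‖R̂₀ − R₀‖₂ ≤ κ δ^{b/(1+b)} ) ≥ 1 − η. -/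

import Mathlib

open MeasureTheory
open scoped InnerProductSpace

set_option linter.unusedSectionVars false

lemma aux_norm_le_of_quad {E : Type*} [NormedAddCommGroup E] [InnerProductSpace ℝ E]
    (Z : E →L[ℝ] E) (hZ : (Z : E →ₗ[ℝ] E).IsSymmetric) (m : ℝ) (hm : 0 ≤ m)
    (h : ∀ x, |⟪Z x, x⟫_ℝ| ≤ m * ‖x‖ ^ 2) : ‖Z‖ ≤ m := by
  rw [Z.norm_eq_iSup_rayleighQuotient hZ]
  refine ciSup_le fun x => ?_
  rw [ContinuousLinearMap.rayleighQuotient, abs_div, abs_sq]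
  exact div_le_of_le_mul₀ (by positivity) hm (by simpa [ContinuousLinearMap.reApplyInnerSelf] using h x)

lemma aux_sylvester {E : Type*} [NormedAddCommGroup E] [InnerProductSpace ℝ E]
    (X Y : E →L[ℝ] E) (hX : (X : E →ₗ[ℝ] E).IsSymmetric) (hY : (Y : E →ₗ[ℝ] E).IsSymmetric)
    (a d : ℝ) (ha : 0 < a) (hXa : ∀ x, a * ‖x‖ ^ 2 ≤ ⟪X x, x⟫_ℝ)
    (hYa : ∀ x, a * ‖x‖ ^ 2 ≤ ⟪Y x, x⟫_ℝ) (hd : ‖X * X - Y * Y‖ ≤ d) :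
    2 * a * ‖X - Y‖ ≤ d := by
  by_contra! hlt
  have hd0 : 0 ≤ d := (norm_nonneg _).trans hd
  set Z := X - Y with hZdef
  have hZ : (Z : E →ₗ[ℝ] E).IsSymmetric := by
    intro x y
    have h1 := hX x y
    have h2 := hY x y
    simp only [ContinuousLinearMap.coe_coe] at h1 h2
    simp [hZdef, inner_sub_left, inner_sub_right, h1, h2]
  have hl : 0 < ‖Z‖ := by
    by_contra! h
    nlinarith [norm_nonneg Z]
  set l := ‖Z‖ with hldef
  set M := ‖X‖ + ‖Y‖ + 1 with hM
  have hM0 : 0 < M := by positivity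
  set τ := (2 * a * l - d) / M with hτ
  have hτ0 : 0 < τ := by apply div_pos <;> linarith
  have hτM : τ * M = 2 * a * l - d := by rw [hτ]; field_simp
  set η := min l (τ ^ 2 / (2 * l)) with hη
  have hη0 : 0 < η := by positivity
  have hη1 : 2 * l * η ≤ τ ^ 2 := by
    have : η ≤ τ ^ 2 / (2 * l) := min_le_right _ _
    rw [le_div_iff₀ (by positivity)] at this
    linarith
  obtain ⟨v, hv⟩ : ∃ v, (l - η) * ‖v‖ ^ 2 < |⟪Z v, v⟫_ℝ| := by
    by_contra! h
    have := aux_norm_le_of_quad Z hZ (l - η) (by linarith [min_le_left l (τ ^ 2 / (2 * l))]) h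
    linarith
  obtain ⟨σ, hσ, hσv⟩ : ∃ σ : ℝ, σ ^ 2 = 1 ∧ |⟪Z v, v⟫_ℝ| = σ * ⟪Z v, v⟫_ℝ := by
    rcases abs_cases ⟪Z v, v⟫_ℝ with h | h
    · exact ⟨1, by norm_num, by rw [h.1]; ring⟩
    · exact ⟨-1, by norm_num, by rw [h.1]; ring⟩
  rw [hσv] at hv
  have hσabs : |σ| = 1 := by
    rcases (sq_eq_sq_iff_eq_or_eq_neg.mp (hσ.trans (one_pow 2).symm)) with h | h <;> simp [h]
  have hv0 : v ≠ 0 := by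
    rintro rfl
    simp at hv
  have hvp : 0 < ‖v‖ := norm_pos_iff.mpr hv0
  set p := Z v - (σ * l) • v with hp
  have hpn : ‖p‖ ^ 2 ≤ (τ * ‖v‖) ^ 2 := by
    have h1 : ‖p‖ ^ 2 = ‖Z v‖ ^ 2 - 2 * (σ * l * ⟪Z v, v⟫_ℝ) + (σ * l) ^ 2 * ‖v‖ ^ 2 := by
      rw [hp, norm_sub_sq_real, inner_smul_right, norm_smul, mul_pow, Real.norm_eq_abs, sq_abs]
    have h2 : ‖Z v‖ ^ 2 ≤ (l * ‖v‖) ^ 2 := by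
      gcongr
      exact Z.le_opNorm v
    have h3 : (σ * l) ^ 2 = l ^ 2 := by rw [mul_pow, hσ, one_mul]
    rw [h3] at h1
    have h4 : l * ((l - η) * ‖v‖ ^ 2) ≤ l * (σ * ⟪Z v, v⟫_ℝ) := by gcongr
    have h5 : 2 * l * η * ‖v‖ ^ 2 ≤ τ ^ 2 * ‖v‖ ^ 2 := by gcongr
    rw [h1]
    nlinarith
  have hpn' : ‖p‖ ≤ τ * ‖v‖ := by
    apply le_of_sq_le_sq hpn (by positivity)
  have key : ⟪(X * X - Y * Y) v, v⟫_ℝ =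
      ⟪p, X v⟫_ℝ + ⟪Y v, p⟫_ℝ + σ * l * (⟪X v, v⟫_ℝ + ⟪Y v, v⟫_ℝ) := by
    have h1 : (X * X - Y * Y) v = X (Z v) + (X (Y v) - Y (Y v)) := by
      simp [hZdef]
    have h2 : X (Y v) - Y (Y v) = Z (Y v) := by simp [hZdef]
    have h3 : Z v = p + (σ * l) • v := by simp [hp]
    have h4 := hX (Z v) v
    have h5 := hZ (Y v) v
    simp only [ContinuousLinearMap.coe_coe] at h4 h5
    rw [h1, h2, inner_add_left, h4, h5, h3, inner_add_left, inner_add_right, inner_smul_left,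
      inner_smul_right, real_inner_comm (X v) v]
    simp
    ring
  have e1 : |⟪(X * X - Y * Y) v, v⟫_ℝ| ≤ d * ‖v‖ ^ 2 := by
    calc _ ≤ ‖(X * X - Y * Y) v‖ * ‖v‖ := abs_real_inner_le_norm _ _
      _ ≤ (d * ‖v‖) * ‖v‖ := by gcongr; exact (X * X - Y * Y).le_of_opNorm_le hd v
      _ = _ := by ring
  have e2 : |⟪p, X v⟫_ℝ| ≤ τ * ‖X‖ * ‖v‖ ^ 2 := by
    calc _ ≤ ‖p‖ * ‖X v‖ := abs_real_inner_le_norm _ _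
      _ ≤ (τ * ‖v‖) * (‖X‖ * ‖v‖) := by gcongr; exact X.le_opNorm v
      _ = _ := by ring
  have e3 : |⟪Y v, p⟫_ℝ| ≤ τ * ‖Y‖ * ‖v‖ ^ 2 := by
    calc _ ≤ ‖Y v‖ * ‖p‖ := abs_real_inner_le_norm _ _
      _ ≤ (‖Y‖ * ‖v‖) * (τ * ‖v‖) := by gcongr; exact Y.le_opNorm v
      _ = _ := by ring
  have e4 : l * (⟪X v, v⟫_ℝ + ⟪Y v, v⟫_ℝ) =
      |⟪(X * X - Y * Y) v, v⟫_ℝ - ⟪p, X v⟫_ℝ - ⟪Y v, p⟫_ℝ| := by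
    have hpos : 0 ≤ ⟪X v, v⟫_ℝ + ⟪Y v, v⟫_ℝ := by
      have := hXa v
      have := hYa v
      have : 0 ≤ a * ‖v‖ ^ 2 := by positivity
      linarith
    have : ⟪(X * X - Y * Y) v, v⟫_ℝ - ⟪p, X v⟫_ℝ - ⟪Y v, p⟫_ℝ =
      σ * (l * (⟪X v, v⟫_ℝ + ⟪Y v, v⟫_ℝ)) := by rw [key]; ring
    rw [this, abs_mul, hσabs, one_mul, abs_of_nonneg (by positivity)]
  have e5 : |⟪(X * X - Y * Y) v, v⟫_ℝ - ⟪p, X v⟫_ℝ - ⟪Y v, p⟫_ℝ| ≤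
      d * ‖v‖ ^ 2 + τ * ‖X‖ * ‖v‖ ^ 2 + τ * ‖Y‖ * ‖v‖ ^ 2 :=
    (abs_sub _ _).trans (by linarith [abs_sub ⟪(X * X - Y * Y) v, v⟫_ℝ ⟪p, X v⟫_ℝ])
  have e6 : l * (a * ‖v‖ ^ 2 + a * ‖v‖ ^ 2) ≤ l * (⟪X v, v⟫_ℝ + ⟪Y v, v⟫_ℝ) := by
    gcongr
    · exact hXa v
    · exact hYa v
  have e7 : 2 * a * l * ‖v‖ ^ 2 ≤ (d + τ * ‖X‖ + τ * ‖Y‖) * ‖v‖ ^ 2 := by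
    nlinarith
  have e8 := le_of_mul_le_mul_right e7 (by positivity)
  rw [hM] at hτM
  nlinarith

lemma aux_pos_inv {E : Type*} [NormedAddCommGroup E] [InnerProductSpace ℝ E]
    [CompleteSpace E] (Q : E →L[ℝ] E) (hQ : 0 ≤ Q) (a : ℝ) (ha : 0 < a)
    (h : ∀ x, a * ‖x‖ ≤ ‖Q x‖) (hu : ∀ x, a ^ 2 * ‖x‖ ^ 2 ≤ ⟪(Q * Q) x, x⟫_ℝ) :
    IsUnit Q ∧ ‖Ring.inverse Q‖ ≤ a⁻¹ ∧ ∀ x, a * ‖x‖ ^ 2 ≤ ⟪Q x, x⟫_ℝ := by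
  rw [ContinuousLinearMap.nonneg_iff_isPositive] at hQ
  have hsym : ∀ x y, ⟪Q x, y⟫_ℝ = ⟪x, Q y⟫_ℝ := hQ.inner_left_eq_inner_right
  have hU2 : IsUnit (Q * Q) := by
    refine ContinuousLinearMap.isUnit_of_forall_le_norm_inner_map (Q * Q)
      (c := ⟨a ^ 2, by positivity⟩) (by exact_mod_cast pow_pos ha 2) fun x => ?_
    have := hu x
    calc _ = a ^ 2 * ‖x‖ ^ 2 := by change ‖x‖ ^ 2 * a ^ 2 = _; ring
      _ ≤ _ := this
      _ ≤ _ := le_abs_self _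
  have hU : IsUnit Q := by
    have : Commute Q Q := Commute.refl Q
    exact (this.isUnit_mul_iff.mp hU2).1
  have hinvQ : ∀ x, Ring.inverse Q (Q x) = x := fun x => by
    have := Ring.inverse_mul_cancel Q hU
    exact congrArg (fun f : E →L[ℝ] E => f x) this
  have hQinv : ∀ x, Q (Ring.inverse Q x) = x := fun x => by
    have := Ring.mul_inverse_cancel Q hU
    exact congrArg (fun f : E →L[ℝ] E => f x) this
  have hn : ‖Ring.inverse Q‖ ≤ a⁻¹ := by
    refine ContinuousLinearMap.opNorm_le_bound _ (by positivity) fun x => ?_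
    have := h (Ring.inverse Q x)
    rw [hQinv] at this
    rw [inv_mul_eq_div, le_div_iff₀ ha]
    linarith
  refine ⟨hU, hn, fun x => ?_⟩
  -- quadratic discriminant argument
  have hq : ∀ t : ℝ, 0 ≤ ⟪Q x, x⟫_ℝ - 2 * t * ‖x‖ ^ 2 + t ^ 2 * (a⁻¹ * ‖x‖ ^ 2) := by
    intro t
    set w := Ring.inverse Q x with hw
    have hQw : Q w = x := hQinv x
    have h1 := hQ.inner_nonneg_left (x - t • w)
    have h2 : ⟪Q (x - t • w), x - t • w⟫_ℝ =
        ⟪Q x, x⟫_ℝ - 2 * t * ‖x‖ ^ 2 + t ^ 2 * ⟪x, w⟫_ℝ := by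
      simp only [map_sub, map_smul, inner_sub_left, inner_sub_right, inner_smul_left,
        inner_smul_right, hQw, real_inner_self_eq_norm_sq, hsym x w]
      simp
      ring
    have h3 : ⟪x, w⟫_ℝ ≤ a⁻¹ * ‖x‖ ^ 2 := by
      calc _ ≤ ‖x‖ * ‖w‖ := real_inner_le_norm _ _
        _ ≤ ‖x‖ * (a⁻¹ * ‖x‖) := by gcongr; exact (Ring.inverse Q).le_of_opNorm_le hn x
        _ = _ := by ring
    have h4 : t ^ 2 * ⟪x, w⟫_ℝ ≤ t ^ 2 * (a⁻¹ * ‖x‖ ^ 2) := by gcongr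
    rw [h2] at h1
    linarith
  have := hq a
  have e : a ^ 2 * (a⁻¹ * ‖x‖ ^ 2) = a * ‖x‖ ^ 2 := by field_simp
  rw [e] at this
  linarith

lemma aux_sqrt {E : Type*} [NormedAddCommGroup E] [InnerProductSpace ℝ E]
    [CompleteSpace E] (D : E →L[ℝ] E) (hD : 0 ≤ D) (ε : ℝ) (hε : 0 < ε) :
    ∃ B : E →L[ℝ] E, 0 ≤ B ∧ B * B = ε • (1 : E →L[ℝ] E) + D ∧
      ∀ W : E →L[ℝ] E, Commute W D → Commute W B := by
  rw [ContinuousLinearMap.nonneg_iff_isPositive] at hD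
  set c := ε + ‖D‖ with hc
  have hc0 : 0 < c := by positivity
  set r := ‖D‖ / c with hr
  have hr0 : 0 ≤ r := by positivity
  have hr1 : r < 1 := by rw [hr, div_lt_one hc0]; linarith
  set K : E →L[ℝ] E := c⁻¹ • (‖D‖ • (1 : E →L[ℝ] E) - D) with hK
  have hDsa : IsSelfAdjoint D := hD.isSelfAdjoint
  have hKsa : IsSelfAdjoint K := by
    rw [hK]
    exact (IsSelfAdjoint.all _).smul (((IsSelfAdjoint.all _).smul (IsSelfAdjoint.one _)).sub hDsa)
  have hKn : ‖K‖ ≤ r := by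
    refine aux_norm_le_of_quad K hKsa.isSymmetric r hr0 fun x => ?_
    have h1 : 0 ≤ ⟪D x, x⟫_ℝ := hD.inner_nonneg_left x
    have h2 : ⟪D x, x⟫_ℝ ≤ ‖D‖ * ‖x‖ ^ 2 := by
      calc _ ≤ ‖D x‖ * ‖x‖ := real_inner_le_norm _ _
        _ ≤ (‖D‖ * ‖x‖) * ‖x‖ := by gcongr; exact D.le_opNorm x
        _ = _ := by ring
    have h3 : ⟪K x, x⟫_ℝ = c⁻¹ * (‖D‖ * ‖x‖ ^ 2 - ⟪D x, x⟫_ℝ) := by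
      simp [hK, inner_smul_left, inner_sub_left ]
    rw [h3, abs_of_nonneg (mul_nonneg (by positivity) (by linarith)), hr, div_eq_inv_mul, mul_assoc]
    gcongr
    linarith
  let f : (E →L[ℝ] E) → (E →L[ℝ] E) := fun Y => (2⁻¹ : ℝ) • (K + Y * Y)
  let s : Set (E →L[ℝ] E) :=
    Metric.closedBall 0 r ∩ {Y | IsSelfAdjoint Y} ∩ ⋂ W ∈ {W | Commute W K}, {Y | W * Y = Y * W}
  have hs : IsClosed s := by
    refine (Metric.isClosed_closedBall.inter ?_).inter ?_
    · exact isClosed_eq continuous_star continuous_id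
    · refine isClosed_biInter fun W _ => ?_
      exact isClosed_eq (continuous_const.mul continuous_id) (continuous_id.mul continuous_const)
  have hmem : ∀ Y, Y ∈ s ↔ ‖Y‖ ≤ r ∧ IsSelfAdjoint Y ∧ ∀ W, Commute W K → Commute W Y := by
    intro Y
    simp [s, and_assoc, Commute, SemiconjBy]
  have hmaps : Set.MapsTo f s s := by
    intro Y hY
    rw [hmem] at hY ⊢
    obtain ⟨h1, h2, h3⟩ := hY
    refine ⟨?_, ?_, ?_⟩
    · calc ‖f Y‖ ≤ 2⁻¹ * (‖K‖ + ‖Y‖ * ‖Y‖) := by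
            simp only [f]
            rw [norm_smul]
            norm_num
            exact (norm_add_le _ _).trans (by gcongr; exact norm_mul_le _ _)
        _ ≤ 2⁻¹ * (r + r * r) := by gcongr
        _ ≤ r := by nlinarith
    · refine (IsSelfAdjoint.all _).smul (hKsa.add ?_)
      rw [IsSelfAdjoint, star_mul, h2.star_eq]
    · intro W hW
      exact (hW.add_right ((h3 W hW).mul_right (h3 W hW))).smul_right _
  have hcontr : ContractingWith ⟨r, hr0⟩ (hmaps.restrict f s s) := by
    refine ⟨by exact_mod_cast hr1, LipschitzWith.of_dist_le_mul ?_⟩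
    rintro ⟨Y, hY⟩ ⟨Y', hY'⟩
    rw [hmem] at hY hY'
    simp only [Subtype.dist_eq, Set.MapsTo.val_restrict_apply, dist_eq_norm]
    have : f Y - f Y' = (2⁻¹ : ℝ) • (Y * (Y - Y') + (Y - Y') * Y') := by
      simp only [f, ← smul_sub]
      congr 1
      noncomm_ring
    rw [this, norm_smul]
    have h4 : ‖Y * (Y - Y') + (Y - Y') * Y'‖ ≤ r * ‖Y - Y'‖ + ‖Y - Y'‖ * r := by
      refine (norm_add_le _ _).trans (add_le_add ?_ ?_)
      · exact (norm_mul_le _ _).trans (by gcongr; exact hY.1)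
      · exact (norm_mul_le _ _).trans (by gcongr; exact hY'.1)
    change _ ≤ r * ‖Y - Y'‖
    norm_num
    linarith
  have h0 : (0 : E →L[ℝ] E) ∈ s := by
    rw [hmem]
    simp [hr0]
  obtain ⟨Y, hYs, hYfix, -⟩ := hcontr.exists_fixedPoint' hs.isComplete hmaps h0 (edist_ne_top _ _)
  rw [hmem] at hYs
  obtain ⟨hYn, hYsa, hYc⟩ := hYs
  have hYY : Y + Y = K + Y * Y := by
    have : (2⁻¹ : ℝ) • (K + Y * Y) = Y := hYfix
    calc Y + Y = (2 : ℝ) • Y := (two_smul ℝ Y).symm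
      _ = (2 : ℝ) • ((2⁻¹ : ℝ) • (K + Y * Y)) := by rw [this]
      _ = _ := by rw [smul_smul]; norm_num
  refine ⟨√c • (1 - Y), ?_, ?_, ?_⟩
  · rw [ContinuousLinearMap.nonneg_iff_isPositive]
    refine ContinuousLinearMap.IsPositive.smul_of_nonneg ?_ (Real.sqrt_nonneg c)
    rw [ContinuousLinearMap.isPositive_iff']
    refine ⟨(IsSelfAdjoint.one _).sub hYsa, fun x => ?_⟩
    have h2 : ⟪Y x, x⟫_ℝ ≤ 1 * ‖x‖ ^ 2 := by
      calc _ ≤ ‖Y x‖ * ‖x‖ := real_inner_le_norm _ _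
        _ ≤ (1 * ‖x‖) * ‖x‖ := by
          gcongr; exact Y.le_of_opNorm_le (hYn.trans hr1.le) x
        _ = _ := by ring
    simp [inner_sub_left]
    linarith
  · have h1 : (1 - Y) * (1 - Y) = 1 - K := by
      have : (1 - Y) * (1 - Y) = 1 - (Y + Y) + Y * Y := by noncomm_ring
      rw [this, hYY]; abel
    rw [smul_mul_smul_comm, Real.mul_self_sqrt hc0.le, h1, hK, smul_sub, smul_smul,
      mul_inv_cancel₀ hc0.ne', one_smul, hc, add_smul]
    abel
  · intro W hW
    have hWK : Commute W K := by
      rw [hK]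
      exact (((Commute.one_right W).smul_right _).sub_right hW).smul_right _
    exact ((Commute.one_right W).sub_right (hYc W hWK)).smul_right _

/-- `‖A‖₂ ≤ c`, expressed through finite partial sums. -/
def AuxHS {E : Type*} [NormedAddCommGroup E] [InnerProductSpace ℝ E]
    {ι : Type*} (e : HilbertBasis ι ℝ E) (A : E →L[ℝ] E) (c : ℝ) : Prop :=
  0 ≤ c ∧ ∀ s : Finset ι, ∑ i ∈ s, ‖A (e i)‖ ^ 2 ≤ c ^ 2

section HS
variable {E : Type*} [NormedAddCommGroup E] [InnerProductSpace ℝ E] [CompleteSpace E]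
    {ι : Type*} {e : HilbertBasis ι ℝ E}

lemma AuxHS.summable {A : E →L[ℝ] E} {c : ℝ} (h : AuxHS e A c) :
    Summable fun i => ‖A (e i)‖ ^ 2 :=
  summable_of_sum_le (fun _ => by positivity) h.2

lemma AuxHS.sqrt_le {A : E →L[ℝ] E} {c : ℝ} (h : AuxHS e A c) :
    √(∑' i, ‖A (e i)‖ ^ 2) ≤ c :=
  Real.sqrt_le_iff.mpr ⟨h.1, h.summable.tsum_le_of_sum_le h.2⟩

lemma AuxHS.of_sqrt_le {A : E →L[ℝ] E} {c : ℝ} (hs : Summable fun i => ‖A (e i)‖ ^ 2)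
    (h : √(∑' i, ‖A (e i)‖ ^ 2) ≤ c) : AuxHS e A c := by
  obtain ⟨h0, h1⟩ := Real.sqrt_le_iff.mp h
  exact ⟨h0, fun s => (hs.sum_le_tsum s fun _ _ => by positivity).trans h1⟩

lemma AuxHS.mono {A : E →L[ℝ] E} {c d : ℝ} (h : AuxHS e A c) (hcd : c ≤ d) : AuxHS e A d :=
  ⟨h.1.trans hcd, fun s => (h.2 s).trans (by have := h.1; gcongr)⟩

lemma AuxHS.mul_left {A : E →L[ℝ] E} {c : ℝ} (h : AuxHS e A c) (X : E →L[ℝ] E) {m : ℝ}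
    (hm : ‖X‖ ≤ m) : AuxHS e (X * A) (m * c) := by
  have hm0 : 0 ≤ m := (norm_nonneg _).trans hm
  refine ⟨mul_nonneg hm0 h.1, fun s => ?_⟩
  calc ∑ i ∈ s, ‖(X * A) (e i)‖ ^ 2 ≤ ∑ i ∈ s, m ^ 2 * ‖A (e i)‖ ^ 2 := by
        refine Finset.sum_le_sum fun i _ => ?_
        rw [← mul_pow]
        gcongr
        exact X.le_of_opNorm_le hm _
    _ = m ^ 2 * ∑ i ∈ s, ‖A (e i)‖ ^ 2 := by rw [Finset.mul_sum]
    _ ≤ m ^ 2 * c ^ 2 := by gcongr; exact h.2 s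
    _ = _ := by ring

lemma AuxHS.add {A B : E →L[ℝ] E} {c d : ℝ} (hA : AuxHS e A c) (hB : AuxHS e B d) :
    AuxHS e (A + B) (c + d) := by
  refine ⟨add_nonneg hA.1 hB.1, fun s => ?_⟩
  have hcs : (∑ i ∈ s, ‖A (e i)‖ * ‖B (e i)‖) ≤ c * d := by
    refine abs_le_of_sq_le_sq' ?_ (mul_nonneg hA.1 hB.1) |>.2
    refine (Finset.sum_mul_sq_le_sq_mul_sq s _ _).trans ?_
    rw [mul_pow]
    exact mul_le_mul (hA.2 s) (hB.2 s) (Finset.sum_nonneg fun _ _ => by positivity) (by positivity)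
  calc ∑ i ∈ s, ‖(A + B) (e i)‖ ^ 2
      ≤ ∑ i ∈ s, (‖A (e i)‖ ^ 2 + 2 * (‖A (e i)‖ * ‖B (e i)‖) + ‖B (e i)‖ ^ 2) := by
        refine Finset.sum_le_sum fun i _ => ?_
        have : ‖(A + B) (e i)‖ ≤ ‖A (e i)‖ + ‖B (e i)‖ := norm_add_le _ _
        calc _ ≤ (‖A (e i)‖ + ‖B (e i)‖) ^ 2 := by gcongr
          _ = _ := by ring
    _ = ∑ i ∈ s, ‖A (e i)‖ ^ 2 + 2 * ∑ i ∈ s, ‖A (e i)‖ * ‖B (e i)‖ + ∑ i ∈ s, ‖B (e i)‖ ^ 2 := by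
        rw [Finset.sum_add_distrib, Finset.sum_add_distrib, Finset.mul_sum]
    _ ≤ (c + d) ^ 2 := by nlinarith [hA.2 s, hB.2 s]

lemma aux_parseval (e : HilbertBasis ι ℝ E) (x : E) : HasSum (fun i => ⟪e i, x⟫_ℝ ^ 2) (‖x‖ ^ 2) := by
  have := e.hasSum_inner_mul_inner x x
  rw [real_inner_self_eq_norm_sq] at this
  have h2 : (fun i => ⟪e i, x⟫_ℝ ^ 2) = fun i => ⟪x, e i⟫_ℝ * ⟪e i, x⟫_ℝ := by
    funext i
    rw [real_inner_comm x (e i)]; ring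
  rw [h2]
  exact this

lemma AuxHS.adjoint {A : E →L[ℝ] E} {c : ℝ} (h : AuxHS e A c) :
    AuxHS e (ContinuousLinearMap.adjoint A) c := by
  refine ⟨h.1, fun s => ?_⟩
  have h1 : HasSum (fun j => ∑ i ∈ s, ⟪e j, ContinuousLinearMap.adjoint A (e i)⟫_ℝ ^ 2)
      (∑ i ∈ s, ‖ContinuousLinearMap.adjoint A (e i)‖ ^ 2) :=
    hasSum_sum fun i _ => aux_parseval e _
  refine hasSum_le_of_sum_le h1 fun t => ?_
  refine (Finset.sum_le_sum fun j _ => ?_).trans (h.2 t)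
  have := e.orthonormal.sum_inner_products_le (s := s) (A (e j))
  refine le_trans (le_of_eq (Finset.sum_congr rfl fun i _ => ?_)) this
  rw [ContinuousLinearMap.adjoint_inner_right, real_inner_comm, Real.norm_eq_abs, sq_abs]

lemma AuxHS.mul_right {A : E →L[ℝ] E} {c : ℝ} (h : AuxHS e A c) (X : E →L[ℝ] E) {m : ℝ}
    (hm : ‖X‖ ≤ m) : AuxHS e (A * X) (m * c) := by
  have h1 := (h.adjoint.mul_left (ContinuousLinearMap.adjoint X) (m := m) (by simpa using hm)).adjoint
  have h2 : ContinuousLinearMap.adjoint (ContinuousLinearMap.adjoint X * ContinuousLinearMap.adjoint A)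
      = A * X := by
    simp only [← ContinuousLinearMap.star_eq_adjoint, star_mul, star_star]
  rwa [h2] at h1

lemma AuxHS.norm_le {A : E →L[ℝ] E} {c : ℝ} (h : AuxHS e A c) : ‖A‖ ≤ c := by
  have : ‖ContinuousLinearMap.adjoint A‖ ≤ c := by
    refine ContinuousLinearMap.opNorm_le_bound _ h.1 fun x => ?_
    refine le_of_sq_le_sq ?_ (mul_nonneg h.1 (norm_nonneg _))
    refine hasSum_le_of_sum_le (aux_parseval e (ContinuousLinearMap.adjoint A x)) fun t => ?_
    calc _ ≤ ∑ i ∈ t, ‖A (e i)‖ ^ 2 * ‖x‖ ^ 2 := by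
          refine Finset.sum_le_sum fun i _ => ?_
          rw [ContinuousLinearMap.adjoint_inner_right, ← mul_pow, ← sq_abs]
          gcongr
          exact abs_real_inner_le_norm _ _
      _ = (∑ i ∈ t, ‖A (e i)‖ ^ 2) * ‖x‖ ^ 2 := by rw [Finset.sum_mul]
      _ ≤ c ^ 2 * ‖x‖ ^ 2 := by gcongr; exact h.2 t
      _ = _ := by ring
  simpa using this
end HS

lemma aux_mid (g : ℝ → ℝ) (hg : ∀ s, 0 ≤ g s) (hcont : ContinuousOn g (Set.Ioi 0))
    (hmid : ∀ s t, 0 ≤ s → 0 ≤ t → g ((s + t) / 2) ^ 2 ≤ g s * g t)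
    (h0 : g 0 ≤ 1) (h1 : g 1 ≤ 1) (b : ℝ) (hb : 0 < b) (hb1 : b ≤ 1) : g b ≤ 1 := by
  have hm : ∀ s t, 0 ≤ s → 0 ≤ t → g s ≤ 1 → g t ≤ 1 → g ((s + t) / 2) ≤ 1 := by
    intro s t hs ht h2 h3
    have h4 := hmid s t hs ht
    have h5 : g s * g t ≤ 1 := mul_le_one₀ h2 (hg t) h3
    nlinarith [hg ((s + t) / 2)]
  have hdy : ∀ n : ℕ, ∀ m : ℕ, m ≤ 2 ^ n → g ((m : ℝ) / 2 ^ n) ≤ 1 := by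
    intro n
    induction n with
    | zero =>
      intro m hm'
      have : m = 0 ∨ m = 1 := by simp at hm'; omega
      rcases this with rfl | rfl
      · simpa using h0
      · simpa using h1
    | succ n ih =>
      intro m hm'
      rw [pow_succ] at hm'
      have e : (m : ℝ) / 2 ^ (n + 1) =
          (((m / 2 : ℕ) : ℝ) / 2 ^ n + ((m - m / 2 : ℕ) : ℝ) / 2 ^ n) / 2 := by
        have : (m : ℝ) = ((m / 2 : ℕ) : ℝ) + ((m - m / 2 : ℕ) : ℝ) := by
          rw [← Nat.cast_add]; congr 1; omega
        rw [this, pow_succ]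
        field_simp
      rw [e]
      exact hm _ _ (by positivity) (by positivity) (ih _ (by omega)) (ih _ (by omega))
  have hlim : Filter.Tendsto (fun n : ℕ => ((⌊b * 2 ^ n⌋₊ : ℕ) : ℝ) / 2 ^ n) Filter.atTop (nhds b) :=
    (tendsto_nat_floor_mul_div_atTop hb.le).comp (tendsto_pow_atTop_atTop_of_one_lt (r := (2 : ℝ)) (by norm_num))
  have hc : Filter.Tendsto g (nhds b) (nhds (g b)) := (hcont.continuousAt (Ioi_mem_nhds hb))
  refine le_of_tendsto (hc.comp hlim) (Filter.Eventually.of_forall fun n => hdy n _ ?_)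
  refine Nat.floor_le_of_le ?_
  push_cast
  have : (0 : ℝ) < 2 ^ n := by positivity
  nlinarith

section pow
variable {E : Type*} [NormedAddCommGroup E] [InnerProductSpace ℝ E] [CompleteSpace E]
  {D : E →L[ℝ] E} {Dpow : ℝ → E →L[ℝ] E}

lemma aux_moment 
    (hpos : ∀ r, 0 < r → 0 ≤ Dpow r)
    (hadd : ∀ s t, 0 < s → 0 < t → Dpow (s + t) = Dpow s * Dpow t)
    (hone : Dpow 1 = D)
    (hcont : ∀ x : E, ContinuousOn (fun r : ℝ => Dpow r x) (Set.Ioi (0 : ℝ)))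
    (y : E) (u v : ℝ) (hu : 0 < u) (hv : 0 < v) (hyu : ‖y‖ ≤ u) (hyv : ‖D y‖ ≤ v)
    (b : ℝ) (hb : 0 < b) (hb1 : b ≤ 1) : ‖Dpow b y‖ ≤ u ^ (1 - b) * v ^ b := by
  have hsym : ∀ r, 0 < r → ∀ x y, ⟪Dpow r x, y⟫_ℝ = ⟪x, Dpow r y⟫_ℝ := fun r hr =>
    ((ContinuousLinearMap.nonneg_iff_isPositive _).mp (hpos r hr)).inner_left_eq_inner_right
  let F : ℝ → E := fun s => if s = 0 then y else Dpow s y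
  have hF0 : F 0 = y := by simp [F]
  have hF : ∀ s, 0 < s → F s = Dpow s y := fun s hs => by simp [F, hs.ne']
  have hw : ∀ s : ℝ, 0 < u ^ (1 - s) * v ^ s := fun s => by positivity
  have key := aux_mid (fun s => ‖F s‖ / (u ^ (1 - s) * v ^ s)) (fun s => by positivity) ?_ ?_ ?_ ?_
    b hb hb1
  · rw [div_le_one (hw b), hF b hb] at key
    exact key
  · refine ContinuousOn.div ?_ ?_ fun s _ => (hw s).ne'
    · exact (hcont y).norm.congr fun s hs => by rw [hF s hs]
    · apply Continuous.continuousOn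
      exact (continuous_const.rpow (continuous_const.sub continuous_id) fun _ => Or.inl hu.ne').mul
        (continuous_const.rpow continuous_id fun _ => Or.inl hv.ne')
  · intro s t hs ht
    have h1 : ‖F ((s + t) / 2)‖ ^ 2 ≤ ‖F s‖ * ‖F t‖ := by
      rcases hs.eq_or_lt with rfl | hs
      · rcases ht.eq_or_lt with rfl | ht
        · simp [sq]
        · rw [hF0, hF t ht, hF _ (by linarith), ← real_inner_self_eq_norm_sq, hsym _ (by linarith),
            ← mul_apply_eq_comp, ← hadd _ _ (by linarith) (by linarith), zero_add,
            add_halves]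
          exact real_inner_le_norm _ _
      · rcases ht.eq_or_lt with rfl | ht
        · rw [hF0, hF s hs, hF _ (by linarith), ← real_inner_self_eq_norm_sq, hsym _ (by linarith),
            ← mul_apply_eq_comp, ← hadd _ _ (by linarith) (by linarith), add_zero,
            add_halves, mul_comm]
          exact real_inner_le_norm _ _
        · rw [hF t ht, hF s hs, hF _ (by linarith), ← real_inner_self_eq_norm_sq,
            hsym _ (by linarith),
            ← mul_apply_eq_comp, ← hadd _ _ (by linarith) (by linarith),
            add_halves, hadd s t hs ht, mul_apply_eq_comp, ← hsym s hs]
          exact real_inner_le_norm _ _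
    have h2 : (u ^ (1 - (s + t) / 2) * v ^ ((s + t) / 2)) ^ 2 =
        (u ^ (1 - s) * v ^ s) * (u ^ (1 - t) * v ^ t) := by
      have a1 : (u ^ (1 - (s + t) / 2)) ^ 2 = u ^ (1 - s) * u ^ (1 - t) := by
        rw [sq, ← Real.rpow_add hu, ← Real.rpow_add hu]; congr 1; ring
      have a2 : (v ^ ((s + t) / 2)) ^ 2 = v ^ s * v ^ t := by
        rw [sq, ← Real.rpow_add hv, ← Real.rpow_add hv]; congr 1; ring
      rw [mul_pow, a1, a2]; ring
    rw [div_pow, div_mul_div_comm, h2]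
    gcongr
  · simp only [hF0]
    rw [div_le_one (hw 0)]; simpa using hyu
  · simp only [hF 1 one_pos, hone]
    rw [div_le_one (hw 1)]; simpa using hyv

lemma aux_pow_norm 
    (hpos : ∀ r, 0 < r → 0 ≤ Dpow r)
    (hadd : ∀ s t, 0 < s → 0 < t → Dpow (s + t) = Dpow s * Dpow t)
    (hone : Dpow 1 = D)
    (hcont : ∀ x : E, ContinuousOn (fun r : ℝ => Dpow r x) (Set.Ioi (0 : ℝ)))
    (r : ℝ) (hr : 0 < r) : ‖Dpow r‖ ≤ ‖D‖ ^ r := by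
  have main : ∀ m, ‖D‖ < m → ‖Dpow r‖ ≤ m ^ r := by
    intro m hm
    have hm0 : 0 < m := (norm_nonneg _).trans_lt hm
    have base : ∀ b, 0 < b → b ≤ 1 → ‖Dpow b‖ ≤ m ^ b := by
      intro b hb hb1
      refine ContinuousLinearMap.opNorm_le_bound _ (by positivity) fun y => ?_
      by_cases hy : y = 0
      · simp [hy]
      have hy0 : 0 < ‖y‖ := norm_pos_iff.mpr hy
      have := aux_moment hpos hadd hone hcont y ‖y‖ (m * ‖y‖) hy0 (by positivity) le_rfl
        (D.le_of_opNorm_le hm.le y) b hb hb1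
      refine this.trans (le_of_eq ?_)
      rw [Real.mul_rpow hm0.le hy0.le, mul_left_comm, ← Real.rpow_add hy0]
      simp
    have hall : ∀ n : ℕ, ∀ r : ℝ, 0 < r → r ≤ n + 1 → ‖Dpow r‖ ≤ m ^ r := by
      intro n
      induction n with
      | zero => intro r h1 h2; exact base r h1 (by simpa using h2)
      | succ n ih =>
        intro r h1 h2
        by_cases h3 : r ≤ 1
        · exact base r h1 h3
        push Not at h3
        have h4 := hadd (r - 1) 1 (by linarith) one_pos
        rw [sub_add_cancel] at h4
        rw [h4]
        calc _ ≤ ‖Dpow (r - 1)‖ * ‖Dpow 1‖ := norm_mul_le _ _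
          _ ≤ m ^ (r - 1) * m ^ (1 : ℝ) := by
            gcongr
            · exact ih _ (by linarith) (by push_cast at h2; linarith)
            · exact base 1 one_pos le_rfl
          _ = m ^ r := by rw [← Real.rpow_add hm0]; congr 1; ring
    obtain ⟨n, hn⟩ := exists_nat_ge r
    exact hall n r hr (by linarith)
  have hc : Filter.Tendsto (fun m : ℝ => m ^ r) (nhdsWithin ‖D‖ (Set.Ioi ‖D‖)) (nhds (‖D‖ ^ r)) :=
    (Real.continuousAt_rpow_const _ _ (Or.inr hr.le)).tendsto.mono_left nhdsWithin_le_nhds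
  refine ge_of_tendsto hc ?_
  filter_upwards [self_mem_nhdsWithin] with m hm using main m hm
end pow

lemma aux_root {E : Type*} [NormedAddCommGroup E] [InnerProductSpace ℝ E]
    [CompleteSpace E] (D Q : E →L[ℝ] E) (hD : 0 ≤ D) (hQ : 0 ≤ Q) (ε : ℝ) (hε : 0 < ε)
    (hQQ : Q * Q = ε • (1 : E →L[ℝ] E) + D) :
    (∀ x, ‖Q x‖ ^ 2 = ε * ‖x‖ ^ 2 + ⟪D x, x⟫_ℝ) ∧
    IsUnit Q ∧ ‖Ring.inverse Q‖ ≤ (√ε)⁻¹ ∧ ∀ x, √ε * ‖x‖ ^ 2 ≤ ⟪Q x, x⟫_ℝ := by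
  have hD' := (ContinuousLinearMap.nonneg_iff_isPositive _).mp hD
  have hQ' := (ContinuousLinearMap.nonneg_iff_isPositive _).mp hQ
  have h1 : ∀ x, ⟪(Q * Q) x, x⟫_ℝ = ε * ‖x‖ ^ 2 + ⟪D x, x⟫_ℝ := fun x => by
    rw [hQQ]
    simp [inner_add_left, inner_smul_left]
  have h2 : ∀ x, ‖Q x‖ ^ 2 = ε * ‖x‖ ^ 2 + ⟪D x, x⟫_ℝ := fun x => by
    rw [← h1, ← real_inner_self_eq_norm_sq, mul_apply_eq_comp,
      hQ'.inner_left_eq_inner_right (Q x) x]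
  have hs : √ε ^ 2 = ε := Real.sq_sqrt hε.le
  refine ⟨h2, aux_pos_inv Q hQ (√ε) (Real.sqrt_pos.mpr hε) (fun x => ?_) (fun x => ?_)⟩
  · refine le_of_sq_le_sq ?_ (norm_nonneg _)
    rw [h2, mul_pow, hs]
    have := hD'.inner_nonneg_left x
    linarith
  · rw [h1, hs]
    have := hD'.inner_nonneg_left x
    linarith

lemma aux_S {E : Type*} [NormedAddCommGroup E] [InnerProductSpace ℝ E] [CompleteSpace E]
    {D : E →L[ℝ] E} {Dpow : ℝ → E →L[ℝ] E} (hD : 0 ≤ D)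
    (hpos : ∀ r, 0 < r → 0 ≤ Dpow r)
    (hadd : ∀ s t, 0 < s → 0 < t → Dpow (s + t) = Dpow s * Dpow t)
    (hone : Dpow 1 = D)
    (hcont : ∀ x : E, ContinuousOn (fun r : ℝ => Dpow r x) (Set.Ioi (0 : ℝ)))
    (ε : ℝ) (hε : 0 < ε) (B : E →L[ℝ] E) (hB : 0 ≤ B) (hBB : B * B = ε • (1 : E →L[ℝ] E) + D)
    (hBc : ∀ W : E →L[ℝ] E, Commute W D → Commute W B) :
    Commute (Ring.inverse B) (Dpow (1 / 2)) ∧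
    ‖Ring.inverse B * Dpow (1 / 2)‖ ≤ 1 ∧
    (∀ r, 0 < r → Commute (Ring.inverse B * Dpow (1 / 2)) (Dpow r)) ∧
    ∀ b, 0 < b → b ≤ 1 → ‖(Ring.inverse B * Dpow (1 / 2) - 1) * Dpow b‖ ≤ ε ^ b := by
  obtain ⟨hBn, hBu, hBi, -⟩ := aux_root D B hD hB ε hε hBB
  have hD' := (ContinuousLinearMap.nonneg_iff_isPositive _).mp hD
  have hB' := (ContinuousLinearMap.nonneg_iff_isPositive _).mp hB
  have hcomm : ∀ s t, 0 < s → 0 < t → Commute (Dpow s) (Dpow t) := fun s t hs ht => by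
    rw [Commute, SemiconjBy, ← hadd s t hs ht, ← hadd t s ht hs, add_comm]
  have hcB : ∀ r, 0 < r → Commute (Dpow r) B := fun r hr =>
    hBc _ (by rw [← hone]; exact hcomm r 1 hr one_pos)
  set P := Dpow (1 / 2) with hP
  have hP' := (ContinuousLinearMap.nonneg_iff_isPositive _).mp (hpos (1 / 2) (by norm_num))
  rw [← hP] at hP'
  have hPP : P * P = D := by
    rw [hP, ← hadd _ _ (by norm_num) (by norm_num), ← hone]; norm_num
  set Bi := Ring.inverse B with hBidef
  have hBBi : B * Bi = 1 := Ring.mul_inverse_cancel B hBu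
  have hBiB : Bi * B = 1 := Ring.inverse_mul_cancel B hBu
  have hciB : ∀ r, 0 < r → Commute Bi (Dpow r) := fun r hr => by
    have h := (hcB r hr).eq
    calc Bi * Dpow r = Bi * (Dpow r * B) * Bi := by
          rw [mul_assoc, mul_assoc, hBBi, mul_one]
      _ = Dpow r * Bi := by rw [h, ← mul_assoc, hBiB, one_mul]
  have hPB := hcB (1 / 2) (by norm_num)
  have hPBi := hciB (1 / 2) (by norm_num)
  rw [← hP] at hPB hPBi
  have hPle : ∀ x, ‖P x‖ ≤ ‖B x‖ := fun x => by
    refine le_of_sq_le_sq ?_ (norm_nonneg _)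
    rw [hBn, ← hPP, mul_apply_eq_comp, hP'.inner_left_eq_inner_right (P x) x,
      real_inner_self_eq_norm_sq]
    have : 0 ≤ ε * ‖x‖ ^ 2 := by positivity
    linarith
  have hSc : ∀ r, 0 < r → Commute (Bi * P) (Dpow r) := fun r hr =>
    (hciB r hr).mul_left (hcomm _ _ (by norm_num) hr)
  refine ⟨hPBi, ?_, hSc, ?_⟩
  · rw [hPBi.eq]
    refine ContinuousLinearMap.opNorm_le_bound _ zero_le_one fun x => ?_
    have := hPle (Bi x)
    have h2 : B (Bi x) = x := congrArg (fun f : E →L[ℝ] E => f x) hBBi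
    rw [h2] at this
    simpa using this
  -- positivity of the cross term
  have hcross : ∀ w, 0 ≤ ⟪B w, P w⟫_ℝ := fun w => by
    have h4 : P = Dpow (1 / 4) * Dpow (1 / 4) := by
      rw [hP, ← hadd _ _ (by norm_num) (by norm_num)]; norm_num
    have h4' := (ContinuousLinearMap.nonneg_iff_isPositive _).mp (hpos (1 / 4) (by norm_num))
    have h5 : Dpow (1 / 4) (B w) = B (Dpow (1 / 4) w) :=
      congrArg (fun f : E →L[ℝ] E => f w) (hcB (1 / 4) (by norm_num)).eq
    rw [h4, mul_apply_eq_comp, ← h4'.inner_left_eq_inner_right, h5]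
    exact hB'.inner_nonneg_left _
  have hBP : ∀ w, ‖B w‖ ≤ ‖B w + P w‖ := fun w => by
    refine le_of_sq_le_sq ?_ (norm_nonneg _)
    rw [norm_add_sq_real]
    have := hcross w
    have h2 : 0 ≤ ‖P w‖ ^ 2 := by positivity
    linarith
  intro b hb hb1
  refine ContinuousLinearMap.opNorm_le_bound _ (by positivity) fun x => ?_
  by_cases hx : x = 0
  · simp [hx]
  have hx0 : 0 < ‖x‖ := norm_pos_iff.mpr hx
  set v := (Bi * P - 1) x with hv
  have hcv : ((Bi * P - 1) * Dpow b) x = Dpow b v := by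
    have : Commute (Bi * P - 1) (Dpow b) := (hSc b hb).sub_left (Commute.one_left _)
    rw [this.eq]; rfl
  have hop : (B + P) * B * (Bi * P - 1) = -(ε • (1 : E →L[ℝ] E)) := by
    have h1 : B * (Bi * P - 1) = P - B := by rw [mul_sub, ← mul_assoc, hBBi, one_mul, mul_one]
    rw [mul_assoc, h1]
    have h2 : (B + P) * (P - B) = P * P - B * B + (B * P - P * B) := by noncomm_ring
    rw [h2, hPB.eq, hPP, hBB]; abel
  have hvx : B (B v) + P (B v) = -(ε • x) := by
    have := congrArg (fun f : E →L[ℝ] E => f x) hop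
    simpa [hv] using this
  have hBBv : ‖B (B v)‖ ≤ ε * ‖x‖ := by
    refine (hBP (B v)).trans (le_of_eq ?_)
    rw [hvx, norm_neg, norm_smul, Real.norm_of_nonneg hε.le]
  have hsq : ‖B (B v)‖ ^ 2 = ε ^ 2 * ‖v‖ ^ 2 + 2 * ε * ⟪D v, v⟫_ℝ + ‖D v‖ ^ 2 := by
    have : B (B v) = ε • v + D v := by
      have := congrArg (fun f : E →L[ℝ] E => f v) hBB
      simpa using this
    rw [this, norm_add_sq_real, norm_smul, inner_smul_left, real_inner_comm, mul_pow,
      Real.norm_eq_abs, sq_abs]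
    simp
    ring
  have hDv := hD'.inner_nonneg_left v
  have hDv2 : 0 ≤ 2 * ε * ⟪D v, v⟫_ℝ := by positivity
  have hDvn : ‖D v‖ ≤ ε * ‖x‖ := by
    refine le_trans (le_of_sq_le_sq ?_ (norm_nonneg _)) hBBv
    rw [hsq]
    have : 0 ≤ ε ^ 2 * ‖v‖ ^ 2 := by positivity
    linarith
  have hvn : ‖v‖ ≤ ‖x‖ := by
    have : ε * ‖v‖ ≤ ε * ‖x‖ := by
      refine le_trans (le_of_sq_le_sq ?_ (norm_nonneg _)) hBBv
      rw [hsq, mul_pow]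
      have : 0 ≤ ‖D v‖ ^ 2 := by positivity
      linarith
    exact le_of_mul_le_mul_left this hε
  rw [hcv]
  refine (aux_moment hpos hadd hone hcont v ‖x‖ (ε * ‖x‖) hx0 (by positivity) hvn hDvn
    b hb hb1).trans (le_of_eq ?_)
  rw [Real.mul_rpow hε.le hx0.le, mul_left_comm, ← Real.rpow_add hx0]
  simp

lemma aux_det {E : Type*} [NormedAddCommGroup E] [InnerProductSpace ℝ E] [CompleteSpace E]
    {ι : Type*} (e : HilbertBasis ι ℝ E)
    (δ β ε t b : ℝ) (hβ : 0 < β) (hε : 0 < ε) (hb : b = min β 1) (ht : t = ε ^ b)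
    (hδt : δ = ε * t) (ht1 : t ≤ 1)
    (D : E →L[ℝ] E) (hD : 0 ≤ D)
    (Φ : E →L[ℝ] E) (φ : ℝ) (hΦ : AuxHS e Φ φ)
    (Dpow : ℝ → E →L[ℝ] E)
    (hpos : ∀ r, 0 < r → 0 ≤ Dpow r)
    (hadd : ∀ s t, 0 < s → 0 < t → Dpow (s + t) = Dpow s * Dpow t)
    (hone : Dpow 1 = D)
    (hcont : ∀ x : E, ContinuousOn (fun r : ℝ => Dpow r x) (Set.Ioi (0 : ℝ)))
    (Dh : E →L[ℝ] E) (hDh : 0 ≤ Dh) (hDD : AuxHS e (Dh - D) δ)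
    (C : E →L[ℝ] E)
    (hC : AuxHS e (C - Dpow (1 / 2) * (Dpow β * Φ * Dpow β) * Dpow (1 / 2)) δ)
    (ρ : ℝ) (hρ : AuxHS e (Dpow β * Φ * Dpow β) ρ)
    (Q : E →L[ℝ] E) (hQ : 0 ≤ Q) (hQQ : Q * Q = ε • (1 : E →L[ℝ] E) + Dh) :
    AuxHS e (Ring.inverse Q * C * Ring.inverse Q - Dpow β * Φ * Dpow β)
      (8 * max (1 + ρ) (φ * ‖D‖ ^ (2 * β - b)) * t) := by
  obtain ⟨B, hB, hBB, hBc⟩ := aux_sqrt D hD ε hε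
  obtain ⟨hPBi, hS1, hSc, hSb⟩ := aux_S hD hpos hadd hone hcont ε hε B hB hBB hBc
  obtain ⟨-, hBu, hBi, hBco⟩ := aux_root D B hD hB ε hε hBB
  obtain ⟨-, hQu, hQi, hQco⟩ := aux_root Dh Q hDh hQ ε hε hQQ
  have hQsym := ((ContinuousLinearMap.nonneg_iff_isPositive _).mp hQ).isSymmetric
  have hBsym := ((ContinuousLinearMap.nonneg_iff_isPositive _).mp hB).isSymmetric
  have hsε : 0 < √ε := Real.sqrt_pos.mpr hε
  have ht0 : 0 < t := by rw [ht]; positivity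
  have hδ0 : 0 < δ := by rw [hδt]; positivity
  have hb0 : 0 < b := by rw [hb]; positivity
  have hb1 : b ≤ 1 := by rw [hb]; exact min_le_right _ _
  have hbβ : b ≤ β := by rw [hb]; exact min_le_left _ _
  set P := Dpow (1 / 2)
  set G := Dpow β
  set R := G * Φ * G with hR
  set Qi := Ring.inverse Q with hQidef
  set Bi := Ring.inverse B with hBidef
  set S := Bi * P with hS
  have hBQ : ‖B - Q‖ ≤ δ / (2 * √ε) := by
    rw [le_div_iff₀ (by positivity)]
    have h1 : ‖B * B - Q * Q‖ ≤ δ := by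
      rw [hBB, hQQ, add_sub_add_left_eq_sub, norm_sub_rev]
      exact hDD.norm_le
    have := aux_sylvester B Q hBsym hQsym (√ε) δ hsε hBco hQco h1
    linarith
  have hδQ : (√ε)⁻¹ * (δ / (2 * √ε)) = t / 2 := by
    have : √ε * √ε = ε := Real.mul_self_sqrt hε.le
    rw [hδt]
    field_simp
    rw [sq, this]
  have hBBi : B * Bi = 1 := Ring.mul_inverse_cancel B hBu
  have hBiB : Bi * B = 1 := Ring.inverse_mul_cancel B hBu
  have hQQi : Q * Qi = 1 := Ring.mul_inverse_cancel Q hQu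
  have hQiQ : Qi * Q = 1 := Ring.inverse_mul_cancel Q hQu
  have hTS : ‖Qi * P - S‖ ≤ t / 2 := by
    have h1 : Qi * P - S = Qi * (B - Q) * S := by
      rw [mul_sub, sub_mul, hQiQ, one_mul, hS, mul_assoc, ← mul_assoc B, hBBi, one_mul]
    rw [h1, ← hδQ]
    calc _ ≤ ‖Qi‖ * ‖B - Q‖ * ‖S‖ :=
          (norm_mul_le _ _).trans (by gcongr; exact norm_mul_le _ _)
      _ ≤ (√ε)⁻¹ * (δ / (2 * √ε)) * 1 := by gcongr
      _ = _ := mul_one _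
  have hTS' : ‖P * Qi - S‖ ≤ t / 2 := by
    have h1 : P * Qi - S = S * (B - Q) * Qi := by
      rw [mul_sub, sub_mul, mul_assoc S Q, hQQi, mul_one, hS, hPBi.eq, mul_assoc P, hBiB, mul_one]
    rw [h1, ← hδQ]
    calc _ ≤ ‖S‖ * ‖B - Q‖ * ‖Qi‖ :=
          (norm_mul_le _ _).trans (by gcongr; exact norm_mul_le _ _)
      _ ≤ 1 * (δ / (2 * √ε)) * (√ε)⁻¹ := by gcongr
      _ = _ := by ring
  have hT' : ‖P * Qi‖ ≤ 1 + t / 2 := by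
    calc ‖P * Qi‖ = ‖S + (P * Qi - S)‖ := by congr 1; abel
      _ ≤ _ := (norm_add_le _ _).trans (by gcongr)
  have hG : ‖G‖ ≤ ‖D‖ ^ β := aux_pow_norm hpos hadd hone hcont β hβ
  have hSG : ‖(S - 1) * G‖ ≤ t * ‖D‖ ^ (β - b) := by
    rcases hbβ.eq_or_lt with h | h
    · rw [h, sub_self, Real.rpow_zero, mul_one, ht, h]
      exact hSb β hβ (h ▸ hb1)
    · have h1 : G = Dpow b * Dpow (β - b) := by
        rw [← hadd b (β - b) hb0 (by linarith), add_sub_cancel]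
      rw [h1, ← mul_assoc, ht]
      exact (norm_mul_le _ _).trans (mul_le_mul (hSb b hb0 hb1)
        (aux_pow_norm hpos hadd hone hcont _ (by linarith)) (norm_nonneg _) (by positivity))
  have hGS : G * (S - 1) = (S - 1) * G :=
    (((hSc β hβ).symm.sub_right (Commute.one_right _))).eq
  have hDD2 : ‖D‖ ^ (β - b) * ‖D‖ ^ β = ‖D‖ ^ (2 * β - b) := by
    rw [← Real.rpow_add_of_nonneg (norm_nonneg _) (by linarith) hβ.le]; congr 1; ring
  -- the five pieces
  have p1 : AuxHS e (Qi * (C - P * R * P) * Qi) ((√ε)⁻¹ * ((√ε)⁻¹ * δ)) :=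
    (hC.mul_left Qi hQi).mul_right Qi hQi
  have p2 : AuxHS e ((Qi * P - S) * R * (P * Qi)) ((1 + t / 2) * (t / 2 * ρ)) :=
    (hρ.mul_left _ hTS).mul_right _ hT'
  have p3 : AuxHS e (S * R * (P * Qi - S)) (t / 2 * (1 * ρ)) :=
    (hρ.mul_left _ hS1).mul_right _ hTS'
  have p4 : AuxHS e ((S - 1) * G * Φ * G * S) (1 * (‖D‖ ^ β * (t * ‖D‖ ^ (β - b) * φ))) :=
    ((hΦ.mul_left _ hSG).mul_right _ hG).mul_right _ hS1
  have p5 : AuxHS e (G * Φ * ((S - 1) * G)) (t * ‖D‖ ^ (β - b) * (‖D‖ ^ β * φ)) :=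
    (hΦ.mul_left _ hG).mul_right _ hSG
  have hsum : Qi * C * Qi - R = Qi * (C - P * R * P) * Qi + (Qi * P - S) * R * (P * Qi) +
      S * R * (P * Qi - S) + (S - 1) * G * Φ * G * S + G * Φ * (G * (S - 1)) := by
    rw [hR]
    clear_value S P G Qi Bi
    noncomm_ring
  rw [hsum, hGS]
  refine ((((p1.add p2).add p3).add p4).add p5).mono ?_
  have q1 : (√ε)⁻¹ * ((√ε)⁻¹ * δ) = t := by
    have : √ε * √ε = ε := Real.mul_self_sqrt hε.le
    rw [hδt]
    field_simp
    rw [sq, this]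
  have q4 : 1 * (‖D‖ ^ β * (t * ‖D‖ ^ (β - b) * φ)) = t * (φ * ‖D‖ ^ (2 * β - b)) := by
    rw [← hDD2]; ring
  have q5 : t * ‖D‖ ^ (β - b) * (‖D‖ ^ β * φ) = t * (φ * ‖D‖ ^ (2 * β - b)) := by
    rw [← hDD2]; ring
  rw [q1, q4, q5]
  set M := max (1 + ρ) (φ * ‖D‖ ^ (2 * β - b)) with hM
  have m1 : 1 + ρ ≤ M := le_max_left _ _
  have m2 : φ * ‖D‖ ^ (2 * β - b) ≤ M := le_max_right _ _
  have hρ0 : 0 ≤ ρ := hρ.1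
  have a1 : (1 + t / 2) * (t / 2 * ρ) ≤ t * ρ := by
    have : 0 ≤ t * ρ := by positivity
    nlinarith
  have a2 : t * (φ * ‖D‖ ^ (2 * β - b)) ≤ t * M := by gcongr
  have a3 : t * (1 + ρ) ≤ t * M := by gcongr
  have a4 : 0 ≤ t * ρ := by positivity
  nlinarith



/-- Tail-bound transfer from the covariance estimator to the regularized correlation
estimator.  With `R₀ = D^β Φ D^β`, `C₀ = D^{1/2} R₀ D^{1/2}`, random operators `Ĉ₀`, `D̂`,
`0 < δ ≤ 1`, `η ∈ [0,1]`, `b := min(β,1)`, `ε := δ^{1/(1+b)}`,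
`R̂₀ := (εI + D̂)^{−1/2} Ĉ₀ (εI + D̂)^{−1/2}` and
`κ := 8 max(1 + ‖R₀‖₂, ‖Φ‖₂ ‖D‖^{2β−b})`:  if
`P(‖Ĉ₀ − C₀‖₂ ≤ δ and ‖D̂ − D‖₂ ≤ δ) ≥ 1 − η` then
`P(‖R̂₀ − R₀‖₂ ≤ κ δ^{b/(1+b)}) ≥ 1 − η`.
The powers `D^r` (`r > 0`) are given by the continuous functional calculus, characterized
by the defining properties of the positive power semigroup `Dpow`; `(εI + D̂)^{−1/2}` is
the ring inverse of the unique positive square root `Qhat ω` of `εI + D̂ ω`.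
Hilbert–Schmidt norms are computed through a Hilbert basis `(eᵢ)`; `‖D‖` is the operator
norm. -/
theorem stmt_17 {E : Type*} [NormedAddCommGroup E] [InnerProductSpace ℝ E] [CompleteSpace E]
    {ι : Type*} (e : HilbertBasis ι ℝ E)
    {Ω : Type*} [MeasurableSpace Ω] (P : Measure Ω) [IsProbabilityMeasure P]
    (δ β η : ℝ) (hδ0 : 0 < δ) (hδ1 : δ ≤ 1) (hβ : 0 < β) (hη0 : 0 ≤ η) (hη1 : η ≤ 1)
    (D : E →L[ℝ] E) (hD : 0 ≤ D)
    (Φ : E →L[ℝ] E) (hΦ_HS : Summable fun i => ‖Φ (e i)‖ ^ 2)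
    -- the power semigroup `r ↦ D^r` for `r > 0`, i.e. the continuous functional calculus
    (Dpow : ℝ → E →L[ℝ] E)
    (hDpow_pos : ∀ r, 0 < r → 0 ≤ Dpow r)
    (hDpow_add : ∀ s t, 0 < s → 0 < t → Dpow (s + t) = Dpow s * Dpow t)
    (hDpow_one : Dpow 1 = D)
    (hDpow_cont : ∀ x : E, ContinuousOn (fun r : ℝ => Dpow r x) (Set.Ioi (0 : ℝ)))
    -- the random estimators `D̂` (positive, with `D̂ − D` Hilbert–Schmidt) and `Ĉ₀`
    (Dhat : Ω → E →L[ℝ] E) (hDhat : ∀ ω, 0 ≤ Dhat ω)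
    (hDhat_HS : ∀ ω, Summable fun i => ‖(Dhat ω - D) (e i)‖ ^ 2)
    (Chat₀ : Ω → E →L[ℝ] E) (hChat₀_HS : ∀ ω, Summable fun i => ‖(Chat₀ ω) (e i)‖ ^ 2)
    -- `(εI + D̂ ω)^{1/2}` with `ε := δ^{1/(1+b)}`, `b := min β 1`
    (Qhat : Ω → E →L[ℝ] E) (hQhat_pos : ∀ ω, 0 ≤ Qhat ω)
    (hQhat : ∀ ω, Qhat ω * Qhat ω =
      (δ ^ ((1 : ℝ) / (1 + min β 1))) • (1 : E →L[ℝ] E) + Dhat ω)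
    -- the tail condition on the covariance estimates
    (htail : ENNReal.ofReal (1 - η) ≤
      P {ω | Real.sqrt (∑' i,
          ‖(Chat₀ ω - Dpow (1 / 2) * (Dpow β * Φ * Dpow β) * Dpow (1 / 2)) (e i)‖ ^ 2) ≤ δ ∧
        Real.sqrt (∑' i, ‖(Dhat ω - D) (e i)‖ ^ 2) ≤ δ}) :
    ENNReal.ofReal (1 - η) ≤
      P {ω | Real.sqrt (∑' i,
          ‖(Ring.inverse (Qhat ω) * Chat₀ ω * Ring.inverse (Qhat ω) -
              Dpow β * Φ * Dpow β) (e i)‖ ^ 2) ≤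
        8 * max (1 + Real.sqrt (∑' i, ‖(Dpow β * Φ * Dpow β) (e i)‖ ^ 2))
            (Real.sqrt (∑' i, ‖Φ (e i)‖ ^ 2) * ‖D‖ ^ (2 * β - min β 1)) *
          δ ^ (min β 1 / (1 + min β 1))} := by
  set b := min β 1 with hb
  have hb0 : 0 < b := by rw [hb]; positivity
  set ε := δ ^ ((1 : ℝ) / (1 + b)) with hε
  have hε0 : 0 < ε := by positivity
  have ht : δ ^ (b / (1 + b)) = ε ^ b := by
    rw [hε, ← Real.rpow_mul hδ0.le]; congr 1; ring
  have hδt : δ = ε * δ ^ (b / (1 + b)) := by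
    rw [hε, ← Real.rpow_add hδ0]
    have : 1 / (1 + b) + b / (1 + b) = 1 := by field_simp
    rw [this, Real.rpow_one]
  have ht1 : δ ^ (b / (1 + b)) ≤ 1 := Real.rpow_le_one hδ0.le hδ1 (by positivity)
  have hΦ := AuxHS.of_sqrt_le hΦ_HS le_rfl
  have hR0 : AuxHS e (Dpow β * Φ * Dpow β) _ :=
    (hΦ.mul_left (Dpow β) le_rfl).mul_right (Dpow β) le_rfl
  have hC0 : AuxHS e (Dpow (1 / 2) * (Dpow β * Φ * Dpow β) * Dpow (1 / 2)) _ :=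
    (hR0.mul_left _ le_rfl).mul_right _ le_rfl
  have hR := AuxHS.of_sqrt_le hR0.summable le_rfl
  refine htail.trans (measure_mono ?_)
  rintro ω ⟨h1, h2⟩
  have hCω : Summable fun i =>
      ‖(Chat₀ ω - Dpow (1 / 2) * (Dpow β * Φ * Dpow β) * Dpow (1 / 2)) (e i)‖ ^ 2 := by
    have h3 := AuxHS.of_sqrt_le (hChat₀_HS ω) le_rfl
    have h4 := h3.add (hC0.mul_left (-1) le_rfl)
    rw [neg_one_mul, ← sub_eq_add_neg] at h4
    exact h4.summable
  exact (aux_det e δ β ε _ b hβ hε0 hb ht hδt ht1 D hD Φ _ hΦ Dpow hDpow_pos hDpow_add hDpow_one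
    hDpow_cont (Dhat ω) (hDhat ω) (AuxHS.of_sqrt_le (hDhat_HS ω) h2) (Chat₀ ω)
    (AuxHS.of_sqrt_le hCω h1) _ hR (Qhat ω) (hQhat_pos ω) (hQhat ω)).sqrt_le
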